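/- Let H be an elementary abelian 2-hypergroup, G a closed subset of H, and r ∈ G. Then r⁺ ∈ Thick(G), r⁻ ∈ Thin(G), and G = Thick(G)·Thin(G). -/

import Mathlib

namespace HyperPaper

/-- A hypergroup: hypermultiplication `hmul`, inversion `star`, identity `e`,
satisfying (H1) associativity, (H2) unique two-sided identity, (H3) exchange conditions. -/
structure Hypergroup (H : Type*) where
  hmul : H → H → Set H
  star : H → H
  e : H
  idl : ∀ p, hmul e p = {p}
  idr : ∀ p, hmul p e = {p}
  e_unique : ∀ e' : H, (∀ p, hmul e' p = {p} ∧ hmul p e' = {p}) → e' = e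
  assoc : ∀ p q r : H, (⋃ x ∈ hmul p q, hmul x r) = ⋃ x ∈ hmul q r, hmul p x
  h3l : ∀ p q r : H, p ∈ hmul q r ↔ q ∈ hmul p (star r)
  h3r : ∀ p q r : H, p ∈ hmul q r ↔ r ∈ hmul (star q) p

variable {H : Type*}

namespace Hypergroup

/-- Product of two subsets: FG = {a : ∃ b ∈ F, c ∈ G, a ∈ bc}. -/
def smul (hg : Hypergroup H) (F G : Set H) : Set H :=
  {a | ∃ b ∈ F, ∃ c ∈ G, a ∈ hg.hmul b c}

/-- Closed subset: nonempty and G*G ⊆ G. -/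
def IsClosed (hg : Hypergroup H) (G : Set H) : Prop :=
  G.Nonempty ∧ hg.smul (hg.star '' G) G ⊆ G

/-- Thin element: p*p = {e}. -/
def IsThin (hg : Hypergroup H) (p : H) : Prop := hg.hmul (hg.star p) p = {hg.e}

/-- Thick element: not thin. -/
def IsThick (hg : Hypergroup H) (p : H) : Prop := ¬ hg.IsThin p

/-- Involution: p ≠ e and {e, p} is closed. -/
def IsInvolution (hg : Hypergroup H) (p : H) : Prop :=
  p ≠ hg.e ∧ hg.IsClosed {hg.e, p}

/-- ⟨G⟩: smallest closed subset containing G. -/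
def gen (hg : Hypergroup H) (G : Set H) : Set H := ⋂₀ {C | hg.IsClosed C ∧ G ⊆ C}

/-- O_ϑ(G): the thin elements of H lying in G. -/
def Othin (hg : Hypergroup H) (G : Set H) : Set H := {p ∈ G | hg.IsThin p}

/-- F is a strongly normal closed subset of G: p*Fp ⊆ F ⊆ G for all p ∈ G. -/
def IsStronglyNormal (hg : Hypergroup H) (F G : Set H) : Prop :=
  hg.IsClosed F ∧ hg.IsClosed G ∧ F ⊆ G ∧
    ∀ p ∈ G, hg.smul (hg.smul {hg.star p} F) {p} ⊆ F

/-- O^ϑ(G): intersection of all strongly normal closed subsets of ⟨G⟩. -/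
def Osup (hg : Hypergroup H) (G : Set H) : Set H :=
  ⋂₀ {F | hg.IsStronglyNormal F (hg.gen G)}

/-- F is a normal closed subset of G. -/
def IsNormal (hg : Hypergroup H) (F G : Set H) : Prop :=
  hg.IsClosed F ∧ hg.IsClosed G ∧ F ⊆ G ∧ ∀ p ∈ G, hg.smul F {p} = hg.smul {p} F

/-- Product of a list of subsets (empty product is {e}). -/
def listProd (hg : Hypergroup H) : List (Set H) → Set H
  | [] => {hg.e}
  | a :: l => hg.smul a (hg.listProd l)

/-- Product r_1 r_2 ⋯ r_n of a family of elements. -/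
def famProd (hg : Hypergroup H) {n : ℕ} (r : Fin n → H) : Set H :=
  hg.listProd ((List.finRange n).map fun i => ({r i} : Set H))

/-- Ĝ_i: the product of the G_j with j ≠ i. -/
def cofactor (hg : Hypergroup H) {n : ℕ} (G : Fin n → Set H) (i : Fin n) : Set H :=
  hg.listProd (((List.finRange n).filter fun j => decide (j ≠ i)).map G)

/-- H is the direct product of the normal closed subsets G_1, …, G_n. -/
def IsDirectProduct (hg : Hypergroup H) {n : ℕ} (G : Fin n → Set H) : Prop :=
  (∀ i, hg.IsNormal (G i) Set.univ) ∧
  (∀ i, hg.smul (G i) (hg.cofactor G i) = Set.univ) ∧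
  (∀ i, G i ∩ hg.cofactor G i = {hg.e})

/-- r : Fin n → H is a decomposition of x with respect to the family G. -/
def IsDecomp (hg : Hypergroup H) {n : ℕ} (G : Fin n → Set H) (x : H) (r : Fin n → H) : Prop :=
  (∀ i, r i ∈ G i) ∧ x ∈ hg.famProd r

/-- The support of x: the elements ≠ e appearing in the decomposition of x. -/
def dsupport (hg : Hypergroup H) {n : ℕ} (G : Fin n → Set H) (x : H) : Set H :=
  {y | y ≠ hg.e ∧ ∃ r, hg.IsDecomp G x r ∧ y ∈ Set.range r}

/-- The cover of x: the product r_1r_2⋯r_n for the decomposition of x. -/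
def dcover (hg : Hypergroup H) {n : ℕ} (G : Fin n → Set H) (x : H) : Set H :=
  {y | ∃ r, hg.IsDecomp G x r ∧ y ∈ hg.famProd r}

/-- x is constrained: its cover equals {x}. -/
def IsConstrained (hg : Hypergroup H) {n : ℕ} (G : Fin n → Set H) (x : H) : Prop :=
  hg.dcover G x = {x}

/-- r_2(G): the largest 2-rank of a thin closed subset of H contained in G
(equivalently, the largest k such that G contains a thin symmetric closed subset
of 2^k elements, which corresponds to an elementary abelian 2-group of 2-rank k). -/
noncomputable def rank2 (hg : Hypergroup H) (G : Set H) : ℕ :=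
  sSup {k | ∃ U : Set H, hg.IsClosed U ∧ U ⊆ G ∧ (∀ u ∈ U, hg.IsThin u) ∧
    (∀ u ∈ U, hg.star u = u) ∧ U.ncard = 2 ^ k}

/-- F is a minimal generating subset of G. -/
def IsMinGen (hg : Hypergroup H) (G F : Set H) : Prop :=
  F ⊆ G ∧ hg.gen F = G ∧ ∀ p ∈ F, hg.gen (F \ {p}) ≠ G

/-- The dimension of G: the smallest cardinality of a minimal generating subset. -/
noncomputable def dimension (hg : Hypergroup H) (G : Set H) : ℕ :=
  sInf {k | ∃ F : Set H, hg.IsMinGen G F ∧ F.Finite ∧ F.ncard = k}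

/-- [F, G] = ⟨{a : ∃ b ∈ F, c ∈ G, a ∈ b*c*bc}⟩. -/
def commSet (hg : Hypergroup H) (F G : Set H) : Set H :=
  hg.gen {a | ∃ b ∈ F, ∃ c ∈ G,
    a ∈ hg.smul (hg.smul (hg.smul {hg.star b} {hg.star c}) {b}) {c}}

/-- derived G k = G^{(k+1)}: G^{(1)} = G, G^{(r)} = [G^{(r-1)}, G]. -/
def derived (hg : Hypergroup H) (G : Set H) : ℕ → Set H
  | 0 => G
  | k + 1 => hg.commSet (hg.derived G k) G

/-- G is nilpotent: G^{(r)} = {e} for some r. -/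
def IsNilpotent (hg : Hypergroup H) (G : Set H) : Prop :=
  ∃ k : ℕ, hg.derived G k = {hg.e}

/-- G is a residually thin closed subset: there is a chain {e} = F_1, …, F_n = G of
pairwise distinct closed subsets, each strongly normal in the next. -/
def IsResiduallyThin (hg : Hypergroup H) (G : Set H) : Prop :=
  ∃ (m : ℕ) (F : Fin (m + 1) → Set H), Function.Injective F ∧
    F 0 = {hg.e} ∧ F (Fin.last m) = G ∧
    ∀ i : Fin m, hg.IsStronglyNormal (F i.castSucc) (F i.succ)

/-- x^k as a subset: x^0 = {e}, x^{k+1} = x^k · x. -/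
def spow (hg : Hypergroup H) (x : H) : ℕ → Set H
  | 0 => {hg.e}
  | k + 1 => hg.smul (hg.spow x k) {x}

/-- F is a maximal closed subset of G. -/
def IsMaximalClosed (hg : Hypergroup H) (F G : Set H) : Prop :=
  hg.IsClosed F ∧ hg.IsClosed G ∧ F ⊆ G ∧ F ≠ G ∧
    ∀ E : Set H, hg.IsClosed E → F ⊆ E → E ⊆ G → E = F ∨ E = G

/-- The Frattini closed subset of G: the intersection (inside G) of all maximal
closed subsets of G. -/
def frattini (hg : Hypergroup H) (G : Set H) : Set H :=
  G ∩ ⋂₀ {F | hg.IsMaximalClosed F G}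

/-- α is an isomorphism from the closed subset F to the closed subset G. -/
def IsIso (hg : Hypergroup H) (F G : Set H) (α : H → H) : Prop :=
  Set.BijOn α F G ∧ α hg.e = hg.e ∧
    ∀ p ∈ F, ∀ q ∈ F, α '' hg.hmul p q = hg.hmul (α p) (α q)

/-- F ≃ G: there is an isomorphism from F to G. -/
def Isomorphic (hg : Hypergroup H) (F G : Set H) : Prop := ∃ α : H → H, hg.IsIso F G α

/-- Aut(G): the automorphism group of G, realized as the subgroup of permutations of G
that fix e and preserve the hypermultiplication. -/
def autGroup (hg : Hypergroup H) (G : Set H) : Subgroup (Equiv.Perm G) where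
  carrier := {σ | (∀ x : G, (x : H) = hg.e → ((σ x : H)) = hg.e) ∧
    ∀ p q x : G, (x : H) ∈ hg.hmul p q ↔ ((σ x : H)) ∈ hg.hmul (σ p) (σ q)}
  one_mem' := by
    constructor
    · intro x hx; simpa using hx
    · intro p q x; simp
  mul_mem' := by
    rintro σ τ ⟨he1, hm1⟩ ⟨he2, hm2⟩
    refine ⟨fun x hx => ?_, fun p q x => ?_⟩
    · simpa using he1 _ (he2 x hx)
    · simpa using (hm2 p q x).trans (hm1 (τ p) (τ q) (τ x))
  inv_mem' := by
    rintro σ ⟨he, hm⟩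
    refine ⟨fun x hx => ?_, fun p q x => ?_⟩
    · have h2 : σ x = x := Subtype.ext ((he x hx).trans hx.symm)
      have h3 : σ⁻¹ x = x := by
        conv_lhs => rw [← h2]
        simp
      rw [h3]; exact hx
    · have h := hm (σ⁻¹ p) (σ⁻¹ q) (σ⁻¹ x)
      simpa using h.symm

end Hypergroup

/-- An elementary abelian 2-hypergroup: a hypergroup that is the constrained direct
product of the closed subsets ⟨q_1⟩, …, ⟨q_n⟩ generated by involutions q_1, …, q_n. -/
structure EA2Data (H : Type*) where
  hg : Hypergroup H
  n : ℕ
  q : Fin n → H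
  invol : ∀ i, hg.IsInvolution (q i)
  dp : hg.IsDirectProduct fun i => hg.gen {q i}
  constrained : ∀ x : H, hg.IsConstrained (fun i => hg.gen {q i}) x

namespace EA2Data

/-- The family ⟨q_1⟩, …, ⟨q_n⟩. -/
def fam (E : EA2Data H) : Fin E.n → Set H := fun i => E.hg.gen {E.q i}

/-- The support of x. -/
def support (E : EA2Data H) (x : H) : Set H := E.hg.dsupport E.fam x

/-- Thick(F): externally thick elements of H lying in F. -/
def ThickIn (E : EA2Data H) (F : Set H) : Set H :=
  {x ∈ F | x = E.hg.e ∨ ∀ y ∈ E.support x, E.hg.IsThick y}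

/-- Thin(F): externally thin elements of H lying in F. -/
def ThinIn (E : EA2Data H) (F : Set H) : Set H :=
  {x ∈ F | x = E.hg.e ∨ ∀ y ∈ E.support x, E.hg.IsThin y}

/-- The (unique) pair (x⁺, x⁻) with x⁺ ∈ Thick(H), x⁻ ∈ Thin(H), x⁺x⁻ = {x}. -/
noncomputable def pm (E : EA2Data H) (x : H) : H × H :=
  @Classical.epsilon (H × H) ⟨(E.hg.e, E.hg.e)⟩ fun z =>
    z.1 ∈ E.ThickIn Set.univ ∧ z.2 ∈ E.ThinIn Set.univ ∧ E.hg.hmul z.1 z.2 = {x}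

/-- x⁺. -/
noncomputable def plus (E : EA2Data H) (x : H) : H := (E.pm x).1

/-- x⁻. -/
noncomputable def minus (E : EA2Data H) (x : H) : H := (E.pm x).2

/-- s(x): the number of thick elements of H in the support of x. -/
noncomputable def sElem (E : EA2Data H) (x : H) : ℕ :=
  {y ∈ E.support x | E.hg.IsThick y}.ncard

/-- s(G) = max {s(a) : a ∈ G}. -/
noncomputable def sSet (E : EA2Data H) (G : Set H) : ℕ :=
  sSup {k | ∃ a ∈ G, E.sElem a = k}

/-- x ⪯ y: the support of x is contained in the support of y. -/
def ple (E : EA2Data H) (x y : H) : Prop := E.support x ⊆ E.support y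

/-- p♯: the number of thick elements among q_1, …, q_n. -/
noncomputable def psharp (E : EA2Data H) : ℕ := {i : Fin E.n | E.hg.IsThick (E.q i)}.ncard

end EA2Data

/-- The Gaussian binomial coefficient C(n, k)_2 with base 2, via the
q-Pascal recurrence C(n, k)_2 = C(n-1, k-1)_2 + 2^k · C(n-1, k)_2. -/
def gaussBinom2 : ℕ → ℕ → ℕ
  | _, 0 => 1
  | 0, _ + 1 => 0
  | n + 1, k + 1 => gaussBinom2 n k + 2 ^ (k + 1) * gaussBinom2 n (k + 1)

end HyperPaper

namespace HyperPaper

variable {H : Type*}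

namespace Hypergroup

variable (hg : Hypergroup H)

theorem mem_smul {F G : Set H} {a : H} :
    a ∈ hg.smul F G ↔ ∃ b ∈ F, ∃ c ∈ G, a ∈ hg.hmul b c := Iff.rfl

theorem smul_singleton (p q : H) : hg.smul {p} {q} = hg.hmul p q := by
  ext a; simp [mem_smul]

theorem smul_mono {F F' G G' : Set H} (hF : F ⊆ F') (hG : G ⊆ G') :
    hg.smul F G ⊆ hg.smul F' G' := by
  rintro a ⟨b, hb, c, hc, h⟩
  exact ⟨b, hF hb, c, hG hc, h⟩

theorem smul_assoc (F G K : Set H) :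
    hg.smul (hg.smul F G) K = hg.smul F (hg.smul G K) := by
  ext a
  constructor
  · rintro ⟨x, ⟨b, hb, c, hc, hx⟩, d, hd, ha⟩
    have : a ∈ ⋃ x ∈ hg.hmul b c, hg.hmul x d := Set.mem_biUnion hx ha
    rw [hg.assoc] at this
    obtain ⟨y, hy, hay⟩ := Set.mem_iUnion₂.1 this
    exact ⟨b, hb, y, ⟨c, hc, d, hd, hy⟩, hay⟩
  · rintro ⟨b, hb, y, ⟨c, hc, d, hd, hy⟩, ha⟩
    have : a ∈ ⋃ y ∈ hg.hmul c d, hg.hmul b y := Set.mem_biUnion hy ha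
    rw [← hg.assoc] at this
    obtain ⟨x, hx, hax⟩ := Set.mem_iUnion₂.1 this
    exact ⟨x, ⟨b, hb, c, hc, hx⟩, d, hd, hax⟩

theorem smul_e (F : Set H) : hg.smul F {hg.e} = F := by
  ext a; simp [mem_smul, hg.idr]

theorem e_smul (F : Set H) : hg.smul {hg.e} F = F := by
  ext a; simp [mem_smul, hg.idl]

theorem e_mem_star_hmul (p : H) : hg.e ∈ hg.hmul (hg.star p) p := by
  rw [← hg.h3r, hg.idr]; rfl

theorem e_mem_hmul_star (p : H) : hg.e ∈ hg.hmul p (hg.star p) := by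
  rw [← hg.h3l, hg.idl]; rfl

theorem hmul_nonempty (p q : H) : (hg.hmul p q).Nonempty := by
  have : p ∈ hg.smul {p} (hg.smul {q} {hg.star q}) :=
    ⟨p, rfl, hg.e, by rw [smul_singleton]; exact hg.e_mem_hmul_star q, by rw [hg.idr]; rfl⟩
  rw [← smul_assoc, smul_singleton] at this
  obtain ⟨x, hx, -⟩ := this
  exact ⟨x, hx⟩

theorem star_e : hg.star hg.e = hg.e := by
  have := hg.e_mem_star_hmul hg.e
  rw [hg.idr] at this
  exact this.symm

theorem star_mem_hmul {a p q : H} (h : a ∈ hg.hmul p q) :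
    hg.star a ∈ hg.hmul (hg.star q) (hg.star p) := by
  rw [hg.h3l, hg.h3r] at h
  rwa [← hg.h3l]

variable {hg} in
theorem IsClosed.e_mem {G : Set H} (hG : hg.IsClosed G) : hg.e ∈ G := by
  obtain ⟨⟨x, hx⟩, h⟩ := hG
  exact h ⟨hg.star x, ⟨x, hx, rfl⟩, x, hx, hg.e_mem_star_hmul x⟩

theorem listProd_nonempty {ι : Type*} (l : List ι) (r : ι → H) :
    (hg.listProd (l.map fun i => ({r i} : Set H))).Nonempty := by
  induction l with
  | nil => exact ⟨hg.e, rfl⟩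
  | cons a l ih =>
    obtain ⟨y, hy⟩ := ih
    obtain ⟨x, hx⟩ := hg.hmul_nonempty (r a) y
    exact ⟨x, r a, rfl, y, hy, hx⟩

theorem listProd_mono {ι : Type*} (l : List ι) {F G : ι → Set H} (h : ∀ i ∈ l, F i ⊆ G i) :
    hg.listProd (l.map F) ⊆ hg.listProd (l.map G) := by
  induction l with
  | nil => exact subset_rfl
  | cons a l ih =>
    exact hg.smul_mono (h a (by simp)) (ih fun i hi => h i (by simp [hi]))

theorem smul_listProd_comm (K : Set H) (l : List (Set H))
    (h : ∀ F ∈ l, hg.smul K F = hg.smul F K) :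
    hg.smul K (hg.listProd l) = hg.smul (hg.listProd l) K := by
  induction l with
  | nil => simp [listProd, smul_e, e_smul]
  | cons a l ih =>
    simp only [listProd]
    rw [← smul_assoc, h a (by simp), smul_assoc, ih fun F hF => h F (by simp [hF]), smul_assoc]

theorem star_mem_smul (comm : ∀ p q, hg.hmul p q = hg.hmul q p) {F G : Set H}
    (hF : ∀ x ∈ F, hg.star x ∈ F) (hG : ∀ x ∈ G, hg.star x ∈ G) :
    ∀ x ∈ hg.smul F G, hg.star x ∈ hg.smul F G := by
  rintro x ⟨b, hb, c, hc, h⟩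
  exact ⟨_, hF b hb, _, hG c hc, comm _ _ ▸ hg.star_mem_hmul h⟩

theorem star_mem_listProd (comm : ∀ p q, hg.hmul p q = hg.hmul q p) (l : List (Set H))
    (h : ∀ F ∈ l, ∀ x ∈ F, hg.star x ∈ F) :
    ∀ x ∈ hg.listProd l, hg.star x ∈ hg.listProd l := by
  induction l with
  | nil => rintro x rfl; exact hg.star_e
  | cons a l ih =>
    exact hg.star_mem_smul comm (h a (by simp)) (ih fun F hF => h F (by simp [hF]))

variable {hg}

theorem smul_comm (comm : ∀ p q, hg.hmul p q = hg.hmul q p) (F G : Set H) :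
    hg.smul F G = hg.smul G F := by
  ext a
  constructor <;> rintro ⟨b, hb, c, hc, h⟩ <;> exact ⟨c, hc, b, hb, comm b c ▸ h⟩

theorem smul_left_comm (comm : ∀ p q, hg.hmul p q = hg.hmul q p) (F G K : Set H) :
    hg.smul F (hg.smul G K) = hg.smul G (hg.smul F K) := by
  rw [← smul_assoc, smul_comm comm F G, smul_assoc]

theorem smul_smul_smul_comm (comm : ∀ p q, hg.hmul p q = hg.hmul q p)
    (F G K L : Set H) :
    hg.smul (hg.smul F G) (hg.smul K L) = hg.smul (hg.smul F K) (hg.smul G L) := by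
  rw [smul_assoc, smul_left_comm comm G K L, smul_assoc]

theorem listProd_map_smul (comm : ∀ p q, hg.hmul p q = hg.hmul q p)
    {ι : Type*} (l : List ι) (F G : ι → Set H) :
    hg.smul (hg.listProd (l.map F)) (hg.listProd (l.map G)) =
      hg.listProd (l.map fun i => hg.smul (F i) (G i)) := by
  induction l with
  | nil => exact hg.smul_e _
  | cons a l ih =>
    simp only [List.map_cons, listProd]
    rw [smul_smul_smul_comm comm, ih]

theorem listProd_eq_smul_filter (comm : ∀ p q, hg.hmul p q = hg.hmul q p)
    {ι : Type*} [DecidableEq ι] (F : ι → Set H) (i : ι) (l : List ι)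
    (hl : l.Nodup) (hi : i ∈ l) :
    hg.listProd (l.map F) =
      hg.smul (F i) (hg.listProd ((l.filter fun j => decide (j ≠ i)).map F)) := by
  induction l with
  | nil => simp at hi
  | cons a l ih =>
    rw [List.nodup_cons] at hl
    by_cases h : a = i
    · subst h
      have : (l.filter fun j => decide (j ≠ a)) = l := by
        rw [List.filter_eq_self]
        intro j hj
        simp only [decide_eq_true_eq]
        rintro rfl
        exact hl.1 hj
      rw [List.filter_cons_of_neg (by simp), this]
      rfl
    · rw [List.filter_cons_of_pos (by simpa using h)]
      simp only [List.map_cons, listProd]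
      rw [ih hl.2 (by simpa [Ne.symm h] using hi), smul_left_comm comm]

theorem IsInvolution.star_eq {q : H} (hq : hg.IsInvolution q) : hg.star q = q := by
  obtain ⟨hne, -, h⟩ := hq
  have : hg.star q ∈ ({hg.e, q} : Set H) :=
    h ⟨hg.star q, ⟨q, by simp, rfl⟩, hg.e, by simp, by rw [hg.idr]; rfl⟩
  rcases this with h | h
  · have h' := hg.e_mem_star_hmul q
    rw [h, hg.idl] at h'
    exact absurd h'.symm hne
  · exact h

theorem IsInvolution.hmul_self_subset {q : H} (hq : hg.IsInvolution q) :
    hg.hmul q q ⊆ {hg.e, q} := fun _ hx =>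
  hq.2.2 ⟨q, ⟨q, by simp, hq.star_eq⟩, q, by simp, hx⟩

theorem IsInvolution.gen_eq {q : H} (hq : hg.IsInvolution q) :
    hg.gen {q} = {hg.e, q} := by
  apply Set.Subset.antisymm
  · exact Set.sInter_subset_of_mem ⟨hq.2, by simp⟩
  · rintro x hx C ⟨hC, hqC⟩
    rcases hx with rfl | rfl
    · exact hC.e_mem
    · exact hqC rfl

theorem IsInvolution.mem_hmul_self {q : H} (hq : hg.IsInvolution q) (ht : hg.IsThick q) :
    q ∈ hg.hmul q q := by
  by_contra hn
  apply ht
  rw [IsThin, hq.star_eq]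
  apply Set.Subset.antisymm
  · intro x hx
    rcases hq.hmul_self_subset hx with h | h
    · exact h
    · rw [Set.mem_singleton_iff.1 h] at hx
      exact absurd hx hn
  · rintro x rfl
    have := hg.e_mem_star_hmul q
    rwa [hq.star_eq] at this

end Hypergroup

namespace EA2Data

open Hypergroup

variable (E : EA2Data H)

theorem fam_eq (i : Fin E.n) : E.fam i = {E.hg.e, E.q i} := (E.invol i).gen_eq

theorem famProd_eq_singleton {x : H} {r : Fin E.n → H} (h : E.hg.IsDecomp E.fam x r) :
    E.hg.famProd r = {x} := by
  apply Set.Subset.antisymm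
  · intro y hy
    have : y ∈ E.hg.dcover E.fam x := ⟨r, h, hy⟩
    rwa [show E.hg.dcover E.fam x = {x} from E.constrained x] at this
  · rintro _ rfl
    exact h.2

theorem exists_decomp (x : H) : ∃ r, E.hg.IsDecomp E.fam x r := by
  have : x ∈ E.hg.dcover E.fam x := by
    rw [show E.hg.dcover E.fam x = {x} from E.constrained x]; rfl
  obtain ⟨r, hr, -⟩ := this
  exact ⟨r, hr⟩

theorem hmul_involution_comm (i j : Fin E.n) :
    E.hg.hmul (E.q i) (E.q j) = E.hg.hmul (E.q j) (E.q i) := by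
  by_cases hij : E.q i = E.q j
  · rw [hij]
  have key : E.q i ∉ E.hg.hmul (E.q j) (E.q j) := fun h => by
    rcases (E.invol j).hmul_self_subset h with h | h
    · exact (E.invol i).1 h
    · exact hij h
  have h1 : E.q j ∉ E.hg.hmul (E.q i) (E.q j) := by
    rwa [E.hg.h3l, (E.invol j).star_eq]
  have h2 : E.q j ∉ E.hg.hmul (E.q j) (E.q i) := by
    rwa [E.hg.h3r, (E.invol j).star_eq]
  have hn := (E.dp.1 i).2.2.2 (E.q j) trivial
  simp only [(E.invol i).gen_eq] at hn
  ext x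
  have hx := Set.ext_iff.1 hn x
  simp only [mem_smul, Set.mem_insert_iff, Set.mem_singleton_iff, exists_eq_or_imp,
    exists_eq_left, E.hg.idl, E.hg.idr] at hx
  grind

theorem hmul_comm (x y : H) : E.hg.hmul x y = E.hg.hmul y x := by
  obtain ⟨r, hr⟩ := E.exists_decomp x
  obtain ⟨s, hs⟩ := E.exists_decomp y
  rw [← smul_singleton, ← smul_singleton, ← E.famProd_eq_singleton hr,
    ← E.famProd_eq_singleton hs]
  apply smul_listProd_comm
  simp only [List.mem_map, forall_exists_index, List.mem_finRange, true_and]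
  rintro _ j rfl
  symm
  apply smul_listProd_comm
  simp only [List.mem_map, forall_exists_index, List.mem_finRange, true_and]
  rintro _ i rfl
  have hi := hr.1 i
  have hj := hs.1 j
  rw [fam_eq] at hi hj
  simp only [smul_singleton]
  rcases hi with hi | hi
  · rw [hi, E.hg.idl, E.hg.idr]
  · rcases hj with hj | hj
    · rw [hj, E.hg.idl, E.hg.idr]
    · rw [hi, hj, E.hmul_involution_comm]

theorem star_eq (x : H) : E.hg.star x = x := by
  obtain ⟨r, hr⟩ := E.exists_decomp x
  have h : E.hg.star x ∈ E.hg.famProd r := by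
    refine E.hg.star_mem_listProd E.hmul_comm _ ?_ x hr.2
    simp only [List.mem_map, forall_exists_index, List.mem_finRange, true_and]
    rintro _ i rfl y rfl
    have hi := hr.1 i
    rw [fam_eq] at hi
    rcases hi with hi | hi
    · rw [hi, star_e]; rfl
    · rw [Set.mem_singleton_iff.1 hi, (E.invol i).star_eq]; rfl
  rwa [E.famProd_eq_singleton hr] at h

theorem mem_hmul_left {p q r : H} (h : p ∈ E.hg.hmul q r) : q ∈ E.hg.hmul p r := by
  rwa [E.hg.h3l, E.star_eq] at h

theorem hmul_subset {G : Set H} (hG : E.hg.IsClosed G) {x y : H} (hx : x ∈ G) (hy : y ∈ G) :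
    E.hg.hmul x y ⊆ G := fun _ h => hG.2 ⟨x, ⟨x, hx, E.star_eq x⟩, y, hy, h⟩

theorem cofactor_smul_self_subset (i : Fin E.n) :
    E.hg.smul (E.hg.cofactor E.fam i) (E.hg.cofactor E.fam i) ⊆ E.hg.cofactor E.fam i := by
  unfold cofactor
  rw [listProd_map_smul E.hmul_comm]
  refine E.hg.listProd_mono _ fun j _ => ?_
  rintro x ⟨a, ha, b, hb, hx⟩
  exact E.hmul_subset (E.dp.1 j).1 ha hb hx

theorem not_mem_cofactor (i : Fin E.n) : E.q i ∉ E.hg.cofactor E.fam i := fun h => by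
  have : E.q i ∈ E.fam i ∩ E.hg.cofactor E.fam i := ⟨by simp [fam_eq], h⟩
  rw [show E.fam i ∩ E.hg.cofactor E.fam i = {E.hg.e} from E.dp.2.2 i] at this
  exact (E.invol i).1 this

theorem exists_mem_hmul_cofactor {x : H} {r : Fin E.n → H} (h : E.hg.IsDecomp E.fam x r)
    (i : Fin E.n) : ∃ y ∈ E.hg.cofactor E.fam i, x ∈ E.hg.hmul (r i) y := by
  have hx := h.2
  rw [famProd, listProd_eq_smul_filter E.hmul_comm _ i _ (List.nodup_finRange _)
    (List.mem_finRange i)] at hx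
  obtain ⟨b, rfl, y, hy, hxy⟩ := hx
  exact ⟨y, E.hg.listProd_mono _ (fun j _ => Set.singleton_subset_iff.2 (h.1 j)) hy, hxy⟩

theorem decomp_eq_involution {x : H} {r s : Fin E.n → H} (hr : E.hg.IsDecomp E.fam x r)
    (hs : E.hg.IsDecomp E.fam x s) (i : Fin E.n) (hi : r i = E.q i) : s i = E.q i := by
  have hsi := hs.1 i
  rw [fam_eq] at hsi
  rcases hsi with h | h
  · obtain ⟨y, hy, hxy⟩ := E.exists_mem_hmul_cofactor hr i
    obtain ⟨z, hz, hxz⟩ := E.exists_mem_hmul_cofactor hs i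
    rw [h, E.hg.idl, Set.mem_singleton_iff] at hxz
    subst hxz
    rw [hi] at hxy
    exact absurd (E.cofactor_smul_self_subset i ⟨x, hz, y, hy, E.mem_hmul_left hxy⟩)
      (E.not_mem_cofactor i)
  · exact h

theorem decomp_unique {x : H} {r s : Fin E.n → H} (hr : E.hg.IsDecomp E.fam x r)
    (hs : E.hg.IsDecomp E.fam x s) : r = s := by
  funext i
  have hri := hr.1 i
  have hsi := hs.1 i
  rw [fam_eq] at hri hsi
  rcases hri with h | h
  · rcases hsi with h' | h'
    · rw [h, h']
    · rw [E.decomp_eq_involution hs hr i h', h']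
  · rw [E.decomp_eq_involution hr hs i h, h]

theorem mem_hmul_self_of_mem_thickIn {F : Set H} {a : H} (ha : a ∈ E.ThickIn F) :
    a ∈ E.hg.hmul a a := by
  rcases ha.2 with rfl | h
  · rw [E.hg.idl]; rfl
  obtain ⟨r, hr⟩ := E.exists_decomp a
  rw [← smul_singleton, ← E.famProd_eq_singleton hr, famProd, listProd_map_smul E.hmul_comm]
  refine E.hg.listProd_mono _ (fun i _ => ?_) hr.2
  rw [smul_singleton, Set.singleton_subset_iff]
  by_cases he : r i = E.hg.e
  · rw [he, E.hg.idl]; rfl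
  · have hi := hr.1 i
    rw [fam_eq] at hi
    have ht := h (r i) ⟨he, r, hr, i, rfl⟩
    rw [hi.resolve_left he] at ht ⊢
    exact (E.invol i).mem_hmul_self ht

theorem mem_of_hmul_eq {G : Set H} (hG : E.hg.IsClosed G) {a b x : H} (hx : x ∈ G)
    (ha : a ∈ E.hg.hmul a a) (h : E.hg.hmul a b = {x}) : a ∈ G ∧ b ∈ G := by
  have haG : a ∈ G := by
    apply E.hmul_subset hG hx hx
    rw [← smul_singleton, ← h, ← smul_singleton, smul_smul_smul_comm E.hmul_comm,
      smul_singleton, smul_singleton]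
    refine ⟨a, ha, E.hg.e, ?_, by rw [E.hg.idr]; rfl⟩
    have := E.hg.e_mem_star_hmul b
    rwa [E.star_eq] at this
  refine ⟨haG, E.hmul_subset hG hx haG (E.mem_hmul_left ?_)⟩
  rw [E.hmul_comm, h]; rfl

theorem exists_thick_thin (x : H) : ∃ z : H × H,
    z.1 ∈ E.ThickIn Set.univ ∧ z.2 ∈ E.ThinIn Set.univ ∧ E.hg.hmul z.1 z.2 = {x} := by
  classical
  obtain ⟨r, hr⟩ := E.exists_decomp x
  have he : ∀ i, E.hg.e ∈ E.fam i := fun i => (E.dp.1 i).1.e_mem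
  let s : Fin E.n → H := fun i => if E.hg.IsThick (r i) then r i else E.hg.e
  let t : Fin E.n → H := fun i => if E.hg.IsThick (r i) then E.hg.e else r i
  obtain ⟨a, ha⟩ : (E.hg.famProd s).Nonempty := E.hg.listProd_nonempty _ s
  obtain ⟨b, hb⟩ : (E.hg.famProd t).Nonempty := E.hg.listProd_nonempty _ t
  have hs : E.hg.IsDecomp E.fam a s := by
    refine ⟨fun i => ?_, ha⟩
    by_cases h : E.hg.IsThick (r i)
    · simpa [s, h] using hr.1 i
    · simpa [s, h] using he i
  have ht : E.hg.IsDecomp E.fam b t := by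
    refine ⟨fun i => ?_, hb⟩
    by_cases h : E.hg.IsThick (r i)
    · simpa [t, h] using he i
    · simpa [t, h] using hr.1 i
  refine ⟨(a, b), ⟨trivial, .inr ?_⟩, ⟨trivial, .inr ?_⟩, ?_⟩
  · rintro y ⟨hy, s', hs', i, rfl⟩
    obtain rfl := E.decomp_unique hs hs'
    by_cases h : E.hg.IsThick (r i)
    · simp [s, h]
    · simp [s, h] at hy
  · rintro y ⟨hy, t', ht', i, rfl⟩
    obtain rfl := E.decomp_unique ht ht'
    by_cases h : E.hg.IsThick (r i)
    · simp [t, h] at hy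
    · simpa [t, h] using not_not.1 h
  · change E.hg.hmul a b = {x}
    rw [← smul_singleton, ← E.famProd_eq_singleton hs, ← E.famProd_eq_singleton ht,
      ← E.famProd_eq_singleton hr, famProd, famProd, famProd, listProd_map_smul E.hmul_comm]
    congr 2
    funext i
    by_cases h : E.hg.IsThick (r i) <;> simp [s, t, h, smul_e, e_smul]

theorem pm_spec (x : H) : E.plus x ∈ E.ThickIn Set.univ ∧ E.minus x ∈ E.ThinIn Set.univ ∧
    E.hg.hmul (E.plus x) (E.minus x) = {x} :=
  Classical.epsilon_spec (E.exists_thick_thin x)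

theorem plus_mem_and_minus_mem {G : Set H} (hG : E.hg.IsClosed G) {x : H} (hx : x ∈ G) :
    E.plus x ∈ E.ThickIn G ∧ E.minus x ∈ E.ThinIn G := by
  obtain ⟨hp, hm, h⟩ := E.pm_spec x
  obtain ⟨h1, h2⟩ := E.mem_of_hmul_eq hG hx (E.mem_hmul_self_of_mem_thickIn hp) h
  exact ⟨⟨h1, hp.2⟩, ⟨h2, hm.2⟩⟩

end EA2Data

end HyperPaper

open HyperPaper

/-- For a closed subset G of an elementary abelian 2-hypergroup and r ∈ G:
r⁺ ∈ Thick(G), r⁻ ∈ Thin(G), and G = Thick(G)·Thin(G). -/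
theorem stmt2 {H : Type*} (E : EA2Data H) (G : Set H) (hG : E.hg.IsClosed G)
    (r : H) (hr : r ∈ G) :
    E.plus r ∈ E.ThickIn G ∧ E.minus r ∈ E.ThinIn G ∧
      G = E.hg.smul (E.ThickIn G) (E.ThinIn G) := by
  refine ⟨(E.plus_mem_and_minus_mem hG hr).1, (E.plus_mem_and_minus_mem hG hr).2, ?_⟩
  apply Set.Subset.antisymm
  · intro x hx
    obtain ⟨hp, hm⟩ := E.plus_mem_and_minus_mem hG hx
    exact ⟨_, hp, _, hm, by rw [(E.pm_spec x).2.2]; rfl⟩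
  · rintro x ⟨a, ha, b, hb, hx⟩
    exact E.hmul_subset hG ha.1 hb.1 hx
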